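/- Let n ≡ 5 or 7 (mod 8) be a positive integer. Then sum_{k=0}^{(n-1)/2} [10k+4] * (q;q^2)_k (q^3;q^2)_k (q^2;q^2)_{3k} (q^4;q^8)_k / ((q^{11};q^8)_k (q^9;q^8)_k (q^2;q^2)_{2k} (q^6;q^4)_k (q^2;q^2)_k) * q^{2k} ≡ 0 (mod Phi_n(q)), as rational functions in q with denominators coprime to Phi_n(q). -/

import Mathlib

open Finset Polynomial

/-- The `q`-shifted factorial `(a;q)_k`. -/
noncomputable def qp {F : Type*} [Field F] (a q : F) (k : ℕ) : F :=
  ∏ j ∈ Finset.range k, (1 - a * q ^ j)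

/-- The `q`-integer `[m]` as a rational function. -/
noncomputable def qint (m : ℕ) : RatFunc ℚ :=
  ∑ i ∈ Finset.range m, RatFunc.X ^ i

/-- The `q`-integer `[m]` as a polynomial. -/
noncomputable def qnat (m : ℕ) : Polynomial ℚ :=
  ∑ i ∈ Finset.range m, Polynomial.X ^ i

/-- The `q`-binomial coefficient as a rational function. -/
noncomputable def qbin (n k : ℕ) : RatFunc ℚ :=
  qp RatFunc.X RatFunc.X n / (qp RatFunc.X RatFunc.X k * qp RatFunc.X RatFunc.X (n - k))

section BibasicSums

variable {F : Type*} [Field F]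

lemma qp_zero (a q : F) : qp a q 0 = 1 := by simp [qp]

lemma qp_succ (a q : F) (k : ℕ) : qp a q (k + 1) = qp a q k * (1 - a * q ^ k) := by
  simp [qp, Finset.prod_range_succ]

lemma qp_ne_zero {a q : F} {k : ℕ} (h : ∀ j < k, a * q ^ j ≠ 1) : qp a q k ≠ 0 :=
  Finset.prod_ne_zero_iff.2 fun j hj =>
    sub_ne_zero.2 (h j (Finset.mem_range.1 hj)).symm

lemma qp_self_ne_zero {q : F} (hq : ∀ m : ℕ, 0 < m → q ^ m ≠ 1) {s : ℕ} (hs : 0 < s) (t k : ℕ) :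
    qp (q ^ s) (q ^ t) k ≠ 0 := by
  refine qp_ne_zero fun j _ => ?_
  rw [← pow_mul, ← pow_add]
  exact hq _ (by omega)

/-- The reciprocal `1 / (q;q)_z`, equal to `0` at negative integers. -/
noncomputable def recipQp (q : F) (z : ℤ) : F :=
  if z < 0 then 0 else (qp q q z.toNat)⁻¹

lemma recipQp_of_neg (q : F) {z : ℤ} (hz : z < 0) : recipQp q z = 0 := by
  simp [recipQp, hz]

lemma recipQp_natCast (q : F) (k : ℕ) : recipQp q k = (qp q q k)⁻¹ := by
  simp [recipQp]

lemma recipQp_eq_mul {q : F} (hq : ∀ m : ℕ, 0 < m → q ^ m ≠ 1) {z w : ℤ} (h : w = z + 1) :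
    recipQp q z = (1 - q ^ w) * recipQp q w := by
  subst h
  rcases lt_trichotomy z (-1) with hz | rfl | hz
  · rw [recipQp_of_neg q (by omega : z < 0), recipQp_of_neg q (by omega : z + 1 < 0), mul_zero]
  · simp [recipQp]
  · lift z to ℕ using by omega
    have h1 : q ^ (z + 1) ≠ 1 := hq _ z.succ_pos
    have h2 : (1 : F) - q * q ^ z ≠ 0 := by
      rw [← pow_succ']
      exact sub_ne_zero.2 h1.symm
    rw [← Nat.cast_succ, recipQp_natCast, recipQp_natCast, zpow_natCast, Nat.succ_eq_add_one,
      qp_succ, mul_inv, pow_succ']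
    field_simp

/-- The summand of a terminating very-well-poised series in base `q ^ 4`. -/
noncomputable def wpTerm (q : F) (k i : ℕ) : F :=
  (-1) ^ i * q ^ (6 * i ^ 2) * (1 - q ^ (8 * i + 2)) * qp (q ^ 2) (q ^ 4) i / qp (q ^ 4) (q ^ 4) i *
    (qp (q ^ 2) (q ^ 4) (k + i) * qp (q ^ 4) (q ^ 4) (k - 1 - i) *
      recipQp q (k - 4 * i) * recipQp q (k + 4 * i + 2))

/-- The companion of `wpTerm` under the shift `k ↦ k + 1`. -/
noncomputable def wpCompanion (q : F) (k i : ℕ) : F :=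
  (-1) ^ i * q ^ (6 * i ^ 2 : ℤ) * q ^ (-4 * i : ℤ) *
    (1 - q ^ (4 * i)) * qp (q ^ 2) (q ^ 4) i / qp (q ^ 4) (q ^ 4) i *
    (qp (q ^ 2) (q ^ 4) (k + i) * qp (q ^ 4) (q ^ 4) (k - i) *
      recipQp q (k + 1 - 4 * i) * recipQp q (k + 4 * i - 1))

lemma wpTerm_shift {q : F} (hq0 : q ≠ 0) (hq : ∀ m : ℕ, 0 < m → q ^ m ≠ 1) {k : ℕ} (hk : 0 < k)
    (i : ℕ) :
    (1 - q ^ (2 * k + 2)) * (1 - q ^ (k + 1)) * (1 - q ^ (2 * k + 3)) * (1 - q ^ (2 * k + 1)) *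
        wpTerm q (k + 1) i -
      (1 - q ^ (3 * k)) * (1 - q ^ (3 * k + 1)) * (1 - q ^ (3 * k + 2)) * (1 - q ^ (4 * k + 2)) *
        wpTerm q k i =
    -(q ^ (k + 1) * (1 - q ^ (5 * k + 3))) * (wpCompanion q k (i + 1) - wpCompanion q k i) := by
  by_cases hik : k + 1 < 4 * i
  · simp only [wpTerm, wpCompanion]
    rw [recipQp_of_neg q (by push_cast; omega : ((k + 1 : ℕ) : ℤ) - 4 * i < 0),
      recipQp_of_neg q (by omega : (k : ℤ) - 4 * i < 0),
      recipQp_of_neg q (by omega : (k : ℤ) + 1 - 4 * i < 0),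
      recipQp_of_neg q (by push_cast; omega : (k : ℤ) + 1 - 4 * (i + 1 : ℕ) < 0)]
    ring
  · obtain ⟨m, rfl⟩ : ∃ m, k = i + 1 + m := ⟨k - 1 - i, by omega⟩
    have hB1 : (1 : F) - q ^ 4 * (q ^ 4) ^ i ≠ 0 := by
      rw [← pow_mul, ← pow_add]
      exact sub_ne_zero.2 (hq _ (by omega)).symm
    have hBi : qp (q ^ 4) (q ^ 4) i ≠ 0 := qp_self_ne_zero hq (by norm_num) 4 i
    simp only [wpTerm, wpCompanion]
    rw [show i + 1 + m + 1 - 1 - i = m + 1 by omega, show i + 1 + m - 1 - i = m by omega,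
      show i + 1 + m - (i + 1) = m by omega, show i + 1 + m - i = m + 1 by omega,
      show i + 1 + m + 1 + i = (i + 1 + m + i) + 1 by omega,
      show i + 1 + m + (i + 1) = (i + 1 + m + i) + 1 by omega]
    push_cast
    set z : ℤ := i + 1 + m + 1 - 4 * i with hz
    set w : ℤ := i + 1 + m + 4 * i + 3 with hw
    have r1 : recipQp q ((i : ℤ) + 1 + m - 4 * i) = (1 - q ^ z) * recipQp q z :=
      recipQp_eq_mul hq (by omega)
    have r2 : recipQp q ((i : ℤ) + 1 + m + 1 - 4 * (i + 1)) =
        (1 - q ^ (z - 3)) * ((1 - q ^ (z - 2)) * ((1 - q ^ (z - 1)) *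
          ((1 - q ^ z) * recipQp q z))) := by
      rw [recipQp_eq_mul hq (w := z - 3) (by omega),
        recipQp_eq_mul hq (z := z - 3) (w := z - 2) (by omega),
        recipQp_eq_mul hq (z := z - 2) (w := z - 1) (by omega),
        recipQp_eq_mul hq (z := z - 1) (w := z) (by omega)]
    have s0 : recipQp q ((i : ℤ) + 1 + m + 1 + 4 * i + 2) = recipQp q w := by
      congr 1; omega
    have s1 : recipQp q ((i : ℤ) + 1 + m + 4 * i + 2) = (1 - q ^ w) * recipQp q w :=
      recipQp_eq_mul hq (by omega)
    have s2 : recipQp q ((i : ℤ) + 1 + m + 4 * (i + 1) - 1) = recipQp q w := by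
      congr 1; omega
    have s3 : recipQp q ((i : ℤ) + 1 + m + 4 * i - 1) =
        (1 - q ^ (w - 3)) * ((1 - q ^ (w - 2)) * ((1 - q ^ (w - 1)) *
          ((1 - q ^ w) * recipQp q w))) := by
      rw [recipQp_eq_mul hq (w := w - 3) (by omega),
        recipQp_eq_mul hq (z := w - 3) (w := w - 2) (by omega),
        recipQp_eq_mul hq (z := w - 2) (w := w - 1) (by omega),
        recipQp_eq_mul hq (z := w - 1) (w := w) (by omega)]
    rw [r1, r2, s0, s1, s2, s3]
    have ez : q ^ z = q ^ 2 * q ^ m / (q ^ i) ^ 3 := by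
      rw [show z = ((2 + m : ℕ) : ℤ) - ((i * 3 : ℕ) : ℤ) by push_cast; omega, zpow_sub₀ hq0,
        zpow_natCast, zpow_natCast, pow_add, pow_mul]
    have ew : q ^ w = q ^ 4 * q ^ m * (q ^ i) ^ 5 := by
      rw [show w = ((4 + m + i * 5 : ℕ) : ℤ) by push_cast; omega, zpow_natCast, pow_add, pow_add,
        pow_mul]
    have es : ∀ (u : ℤ) (t : ℕ), q ^ (u - t) = q ^ u / q ^ t := fun u t => by
      rw [zpow_sub₀ hq0, zpow_natCast]
    have z1 := es z 1
    have z2 := es z 2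
    have z3 := es z 3
    have w1 := es w 1
    have w2 := es w 2
    have w3 := es w 3
    push_cast at z1 z2 z3 w1 w2 w3
    rw [z1, z2, z3, w1, w2, w3, ez, ew]
    have e6 : q ^ (6 * (i : ℤ) ^ 2) = q ^ (6 * i ^ 2) := by
      exact_mod_cast zpow_natCast q (6 * i ^ 2)
    have e6' : q ^ (6 * ((i : ℤ) + 1) ^ 2) = q ^ (6 * i ^ 2) * (q ^ i) ^ 12 * q ^ 6 := by
      rw [show 6 * ((i : ℤ) + 1) ^ 2 = ((6 * i ^ 2 + i * 12 + 6 : ℕ) : ℤ) by push_cast; ring,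
        zpow_natCast, pow_add, pow_add, pow_mul q i]
    have e4 : q ^ (-4 * (i : ℤ)) = ((q ^ i) ^ 4)⁻¹ := by
      rw [show -4 * (i : ℤ) = -((i * 4 : ℕ) : ℤ) by push_cast; ring, zpow_neg, zpow_natCast,
        pow_mul]
    have e4' : q ^ (-4 * ((i : ℤ) + 1)) = ((q ^ i) ^ 4 * q ^ 4)⁻¹ := by
      rw [show -4 * ((i : ℤ) + 1) = -((i * 4 + 4 : ℕ) : ℤ) by push_cast; ring, zpow_neg,
        zpow_natCast, pow_add, pow_mul]
    rw [e6, e6', e4, e4']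
    generalize recipQp q z = R
    generalize recipQp q w = S
    simp only [qp_succ]
    generalize qp (q ^ 4) (q ^ 4) i = Bi at hBi ⊢
    generalize qp (q ^ 4) (q ^ 4) m = Bm
    generalize qp (q ^ 2) (q ^ 4) i = Ai
    generalize qp (q ^ 2) (q ^ 4) (i + 1 + m + i) = Ak
    generalize q ^ (6 * i ^ 2) = E
    have hY : q ^ i ≠ 0 := pow_ne_zero _ hq0
    have p1 : q ^ (8 * i + 2) = (q ^ i) ^ 8 * q ^ 2 := by ring
    have p2 : q ^ (4 * (i + 1)) = q ^ 4 * (q ^ i) ^ 4 := by ring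
    have p3 : q ^ (4 * i) = (q ^ i) ^ 4 := by ring
    have p4 : (q ^ 4) ^ i = (q ^ i) ^ 4 := by ring
    have p5 : (q ^ 4) ^ m = (q ^ m) ^ 4 := by ring
    have p6 : (q ^ 4) ^ (i + 1 + m + i) = (q ^ i) ^ 8 * q ^ 4 * (q ^ m) ^ 4 := by ring
    have k1 : q ^ (i + 1 + m + 1) = (q * q ^ i * q ^ m) * q := by ring
    have k2 : q ^ (2 * (i + 1 + m) + 1) = (q * q ^ i * q ^ m) ^ 2 * q := by ring
    have k3 : q ^ (2 * (i + 1 + m) + 2) = (q * q ^ i * q ^ m) ^ 2 * q ^ 2 := by ring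
    have k4 : q ^ (2 * (i + 1 + m) + 3) = (q * q ^ i * q ^ m) ^ 2 * q ^ 3 := by ring
    have k5 : q ^ (3 * (i + 1 + m)) = (q * q ^ i * q ^ m) ^ 3 := by ring
    have k6 : q ^ (3 * (i + 1 + m) + 1) = (q * q ^ i * q ^ m) ^ 3 * q := by ring
    have k7 : q ^ (3 * (i + 1 + m) + 2) = (q * q ^ i * q ^ m) ^ 3 * q ^ 2 := by ring
    have k8 : q ^ (4 * (i + 1 + m) + 2) = (q * q ^ i * q ^ m) ^ 4 * q ^ 2 := by ring
    have k9 : q ^ (5 * (i + 1 + m) + 3) = (q * q ^ i * q ^ m) ^ 5 * q ^ 3 := by ring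
    rw [p1, p2, p3, p4, p5, p6, k1, k2, k3, k4, k5, k6, k7, k8, k9]
    rw [p4] at hB1
    generalize q ^ i = Y at *
    generalize q ^ m = M at *
    rw [pow_succ (-1 : F) i]
    generalize (-1 : F) ^ i = sg
    field_simp
    ring

lemma sum_wpTerm {q : F} (hq0 : q ≠ 0) (hq : ∀ m : ℕ, 0 < m → q ^ m ≠ 1) {L k : ℕ} (hk : 1 ≤ k)
    (hkL : k < 4 * L) :
    ∑ i ∈ range L, wpTerm q k i =
      qp q q (3 * k) * qp (q ^ 2) (q ^ 4) k /
        (qp q q (2 * k) * qp q q k * qp (q ^ 3) (q ^ 2) k * (1 - q) * (1 - q ^ (3 * k))) := by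
  have hsub : ∀ m : ℕ, 0 < m → (1 : F) - q ^ m ≠ 0 := fun m hm => sub_ne_zero.2 (hq m hm).symm
  have hD : ∀ m, qp q q m ≠ 0 := by simpa using qp_self_ne_zero hq one_pos 1
  have hO : ∀ m, qp (q ^ 3) (q ^ 2) m ≠ 0 := qp_self_ne_zero hq (by norm_num) 2
  induction k, hk using Nat.le_induction with
  | base =>
    rw [Finset.sum_eq_single 0]
    · have h1 := hsub 1 one_pos
      have h2 := hsub 2 two_pos
      have h3 := hsub 3 three_pos
      have e1 : recipQp q (1 : ℤ) = (qp q q 1)⁻¹ := by exact_mod_cast recipQp_natCast q 1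
      have e3 : recipQp q (3 : ℤ) = (qp q q 3)⁻¹ := by exact_mod_cast recipQp_natCast q 3
      norm_num [wpTerm, e1, e3, qp, Finset.prod_range_succ, ← pow_succ']
      rw [pow_one] at h1
      field_simp
    · intro i _ hi
      rw [wpTerm, recipQp_of_neg q (by push_cast; omega)]
      ring
    · intro h
      exact absurd (Finset.mem_range.2 (by omega)) h
  | succ k hk ih =>
    have ih := ih (by omega)
    have hg0 : wpCompanion q k 0 = 0 := by simp [wpCompanion]
    have hgL : wpCompanion q k L = 0 := by
      rw [wpCompanion, recipQp_of_neg q (by omega : (k : ℤ) + 1 - 4 * L < 0)]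
      ring
    have hsum := Finset.sum_congr (rfl : range L = range L) fun i _ => wpTerm_shift hq0 hq hk i
    rw [Finset.sum_sub_distrib, ← Finset.mul_sum, ← Finset.mul_sum, ← Finset.mul_sum,
      Finset.sum_range_sub (wpCompanion q k), hg0, hgL, ih, sub_zero, mul_zero, sub_eq_zero] at hsum
    have c1 := hsub (2 * k + 2) (by omega)
    have c2 := hsub (k + 1) (by omega)
    have c3 := hsub (2 * k + 3) (by omega)
    have c4 := hsub (2 * k + 1) (by omega)
    have c5 := hsub (3 * k) (by omega)
    have c6 := hsub (3 * k + 3) (by omega)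
    have c7 := hsub 1 one_pos
    rw [pow_one] at c7
    refine mul_left_cancel₀ (mul_ne_zero (mul_ne_zero (mul_ne_zero c1 c2) c3) c4) (hsum.trans ?_)
    rw [show 3 * (k + 1) = 3 * k + 1 + 1 + 1 by ring, show 2 * (k + 1) = 2 * k + 1 + 1 by ring]
    simp only [qp_succ]
    have f1 : q * q ^ (3 * k) = q ^ (3 * k + 1) := by ring
    have f2 : q * q ^ (3 * k + 1) = q ^ (3 * k + 2) := by ring
    have f3 : q * q ^ (3 * k + 1 + 1) = q ^ (3 * k + 3) := by ring
    have f4 : q ^ (3 * k + 1 + 1 + 1) = q ^ (3 * k + 3) := by ring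
    have f5 : q * q ^ (2 * k) = q ^ (2 * k + 1) := by ring
    have f6 : q * q ^ (2 * k + 1) = q ^ (2 * k + 2) := by ring
    have f7 : q ^ 3 * (q ^ 2) ^ k = q ^ (2 * k + 3) := by ring
    have f8 : q ^ 2 * (q ^ 4) ^ k = q ^ (4 * k + 2) := by ring
    have f9 : q * q ^ k = q ^ (k + 1) := by ring
    rw [f1, f2, f3, f4, f5, f6, f7, f8, f9]
    have d1 := hD (2 * k)
    have d2 := hD k
    have d3 := hO k
    field_simp

/-- The weight carrying the dependence of the bibasic summand on the free parameter `y`. -/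
noncomputable def bibasicWeight (q y : F) (k : ℕ) : F :=
  ∏ l ∈ range k, (y - q ^ l) * (1 - q ^ (l + 2) * y) /
    ((1 - q ^ (4 * l + 6) * y) * (y - q ^ (4 * l + 4)))

lemma bibasicWeight_succ_mul {q y : F} {k : ℕ} (h₁ : 1 - q ^ (4 * k + 6) * y ≠ 0)
    (h₂ : y - q ^ (4 * k + 4) ≠ 0) :
    bibasicWeight q y (k + 1) * (1 - q ^ (4 * k + 6) * y) * (y - q ^ (4 * k + 4)) =
      bibasicWeight q y k * (y - q ^ k) * (1 - q ^ (k + 2) * y) := by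
  rw [bibasicWeight, Finset.prod_range_succ, ← bibasicWeight, mul_assoc _ (1 - _), mul_assoc,
    div_mul_cancel₀ _ (mul_ne_zero h₁ h₂), mul_assoc]

/-- The summand of an indefinite bibasic sum in bases `q` and `q ^ 4`. -/
noncomputable def bibasicTerm (q y : F) (i k : ℕ) : F :=
  bibasicWeight q y k * (1 - q ^ (5 * k + 2)) * (1 - q ^ (3 * k)) * q ^ k *
    (qp (q ^ 2) (q ^ 4) (k + i) * qp (q ^ 4) (q ^ 4) (k - 1 - i) *
      recipQp q (k - 4 * i) * recipQp q (k + 4 * i + 2))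

/-- The closed form of the partial sums of `bibasicTerm`, up to a factor independent of `k`. -/
noncomputable def bibasicSum (q y : F) (i k : ℕ) : F :=
  bibasicWeight q y k * (1 - q ^ (4 * k + 2) * y) * (y - q ^ (4 * k)) *
    (qp (q ^ 2) (q ^ 4) (k + i) * qp (q ^ 4) (q ^ 4) (k - 1 - i) *
      recipQp q (k - 1 - 4 * i) * recipQp q (k + 4 * i + 1))

lemma bibasicSum_sub {q y : F} (hq0 : q ≠ 0) (hq : ∀ m : ℕ, 0 < m → q ^ m ≠ 1)
    (hy : ∀ l : ℕ, y ≠ q ^ (4 * l + 4)) (hy' : ∀ l : ℕ, q ^ (4 * l + 6) * y ≠ 1)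
    {k : ℕ} (hk : 0 < k) (i : ℕ) :
    q ^ (4 * i) * (bibasicSum q y i (k + 1) - bibasicSum q y i k) =
      (y - q ^ (4 * i)) * (1 - q ^ (4 * i + 2) * y) * bibasicTerm q y i k := by
  by_cases hik : k < 4 * i
  · simp only [bibasicTerm, bibasicSum]
    rw [recipQp_of_neg q (by omega : (k : ℤ) - 4 * i < 0),
      recipQp_of_neg q (by omega : (k : ℤ) - 1 - 4 * i < 0),
      recipQp_of_neg q (by push_cast; omega : ((k + 1 : ℕ) : ℤ) - 1 - 4 * i < 0)]
    ring
  · obtain ⟨m, rfl⟩ : ∃ m, k = i + 1 + m := ⟨k - 1 - i, by omega⟩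
    have g1 : (1 : F) - q ^ (4 * (i + 1 + m) + 6) * y ≠ 0 := sub_ne_zero.2 (hy' _).symm
    have g2 : y - q ^ (4 * (i + 1 + m) + 4) ≠ 0 := sub_ne_zero.2 (hy _)
    simp only [bibasicTerm, bibasicSum]
    rw [show 4 * (i + 1 + m + 1) + 2 = 4 * (i + 1 + m) + 6 by ring,
      show 4 * (i + 1 + m + 1) = 4 * (i + 1 + m) + 4 by ring, bibasicWeight_succ_mul g1 g2,
      show i + 1 + m + 1 - 1 - i = m + 1 by omega, show i + 1 + m - 1 - i = m by omega,
      show i + 1 + m + 1 + i = (i + 1 + m + i) + 1 by omega]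
    push_cast
    set z : ℤ := i + 1 + m - 4 * i with hz
    set w : ℤ := i + 1 + m + 4 * i + 2 with hw
    have r0 : recipQp q ((i : ℤ) + 1 + m + 1 - 1 - 4 * i) = recipQp q z := by
      congr 1; omega
    have r1 : recipQp q ((i : ℤ) + 1 + m - 1 - 4 * i) = (1 - q ^ z) * recipQp q z :=
      recipQp_eq_mul hq (by omega)
    have s0 : recipQp q ((i : ℤ) + 1 + m + 1 + 4 * i + 1) = recipQp q w := by
      congr 1; omega
    have s1 : recipQp q ((i : ℤ) + 1 + m + 4 * i + 1) = (1 - q ^ w) * recipQp q w :=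
      recipQp_eq_mul hq (by omega)
    rw [r0, r1, s0, s1]
    have ez : q ^ z = q * q ^ m / (q ^ i) ^ 3 := by
      rw [show z = ((1 + m : ℕ) : ℤ) - ((i * 3 : ℕ) : ℤ) by push_cast; omega, zpow_sub₀ hq0,
        zpow_natCast, zpow_natCast, pow_add, pow_mul, pow_one]
    have ew : q ^ w = q ^ 3 * q ^ m * (q ^ i) ^ 5 := by
      rw [show w = ((3 + m + i * 5 : ℕ) : ℤ) by push_cast; omega, zpow_natCast, pow_add, pow_add,
        pow_mul]
    rw [ez, ew]
    generalize recipQp q z = R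
    generalize recipQp q w = S
    simp only [qp_succ]
    generalize qp (q ^ 4) (q ^ 4) m = Bm
    generalize qp (q ^ 2) (q ^ 4) (i + 1 + m + i) = Ak
    generalize bibasicWeight q y (i + 1 + m) = W
    have hY : q ^ i ≠ 0 := pow_ne_zero _ hq0
    have p1 : q ^ (4 * i + 2) = (q ^ i) ^ 4 * q ^ 2 := by ring
    have p3 : q ^ (4 * i) = (q ^ i) ^ 4 := by ring
    have p5 : (q ^ 4) ^ m = (q ^ m) ^ 4 := by ring
    have p6 : (q ^ 4) ^ (i + 1 + m + i) = (q ^ i) ^ 8 * q ^ 4 * (q ^ m) ^ 4 := by ring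
    have k0 : q ^ (i + 1 + m) = q * q ^ i * q ^ m := by ring
    have k1 : q ^ (i + 1 + m + 2) = (q * q ^ i * q ^ m) * q ^ 2 := by ring
    have k2 : q ^ (4 * (i + 1 + m)) = (q * q ^ i * q ^ m) ^ 4 := by ring
    have k3 : q ^ (4 * (i + 1 + m) + 2) = (q * q ^ i * q ^ m) ^ 4 * q ^ 2 := by ring
    have k8 : q ^ (3 * (i + 1 + m)) = (q * q ^ i * q ^ m) ^ 3 := by ring
    have k9 : q ^ (5 * (i + 1 + m) + 2) = (q * q ^ i * q ^ m) ^ 5 * q ^ 2 := by ring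
    rw [p1, p3, p5, p6, k0, k1, k2, k3, k8, k9]
    generalize q ^ i = Y at *
    generalize q ^ m = M at *
    field_simp
    ring

lemma bibasicWeight_eq_zero (q : F) (N : ℕ) : bibasicWeight q (q ^ N) (N + 1) = 0 :=
  Finset.prod_eq_zero (Finset.self_mem_range_succ N) (by simp)

lemma sum_bibasicTerm {q : F} (hq0 : q ≠ 0) (hq : ∀ m : ℕ, 0 < m → q ^ m ≠ 1) {N : ℕ}
    (hN : N % 4 ≠ 0) (i : ℕ) :
    ∑ k ∈ range N, bibasicTerm q (q ^ N) i (k + 1) = if i = 0 then -(1 - q)⁻¹ else 0 := by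
  have hinj : ∀ a b : ℕ, a ≠ b → q ^ a ≠ q ^ b := by
    have key : ∀ a b : ℕ, a < b → q ^ a ≠ q ^ b := fun a b hab h => by
      refine hq (b - a) (by omega) (mul_left_cancel₀ (pow_ne_zero a hq0) ?_)
      rw [← pow_add, mul_one, h, Nat.add_sub_cancel' hab.le]
    intro a b hab
    rcases hab.lt_or_gt with h | h
    exacts [key a b h, (key b a h).symm]
  have hK : (q ^ N - q ^ (4 * i)) * (1 - q ^ (4 * i + 2) * q ^ N) ≠ 0 := by
    refine mul_ne_zero (sub_ne_zero.2 (hinj _ _ (by omega))) ?_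
    rw [← pow_add]
    exact sub_ne_zero.2 (hq _ (by omega)).symm
  have htel := Finset.sum_congr (rfl : range N = range N) fun k _ =>
    bibasicSum_sub (y := q ^ N) hq0 hq (fun l => hinj _ _ (by omega))
      (fun l => by rw [← pow_add]; exact hq _ (by omega)) k.succ_pos i
  rw [← Finset.mul_sum, ← Finset.mul_sum,
    Finset.sum_range_sub (fun k => bibasicSum q (q ^ N) i (k + 1))] at htel
  have hend : bibasicSum q (q ^ N) i (N + 1) = 0 := by
    rw [bibasicSum, bibasicWeight_eq_zero]
    ring
  rw [hend] at htel
  refine mul_left_cancel₀ hK (htel.symm.trans ?_)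
  split_ifs with hi
  · subst hi
    have h1 : (1 : F) - q ≠ 0 := by simpa using sub_ne_zero.2 (hq 1 one_pos).symm
    have h2 : (1 : F) - q ^ 2 ≠ 0 := sub_ne_zero.2 (hq 2 two_pos).symm
    have g1 : (1 : F) - q ^ 6 * q ^ N ≠ 0 := by
      rw [← pow_add]
      exact sub_ne_zero.2 (hq _ (by omega)).symm
    have g2 : q ^ N - q ^ 4 ≠ 0 := sub_ne_zero.2 (hinj _ _ (by omega))
    have e0 : recipQp q (0 : ℤ) = (qp q q 0)⁻¹ := by exact_mod_cast recipQp_natCast q 0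
    have e2 : recipQp q (2 : ℤ) = (qp q q 2)⁻¹ := by exact_mod_cast recipQp_natCast q 2
    norm_num [bibasicSum, bibasicWeight, e0, e2, qp, Finset.prod_range_succ, ← pow_succ']
    rw [mul_comm] at g1
    generalize q ^ N = y at *
    field_simp
  · have h0 : bibasicSum q (q ^ N) i (0 + 1) = 0 := by
      rw [bibasicSum, recipQp_of_neg q (by push_cast; omega)]
      ring
    rw [h0]
    ring

/-- Terminating case of the quartic summation of Gasper and Rahman. -/
lemma quartic_sum {q : F} (hq0 : q ≠ 0) (hq : ∀ m : ℕ, 0 < m → q ^ m ≠ 1) {N : ℕ}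
    (hN : N % 4 ≠ 0) :
    ∑ k ∈ range (N + 1), (1 - q ^ (5 * k + 2)) * bibasicWeight q (q ^ N) k *
      (qp q q (3 * k) / (qp q q (2 * k) * qp (q ^ 3) (q ^ 2) k)) *
        (qp (q ^ 2) (q ^ 4) k * q ^ k / qp q q k) = 0 := by
  have h1 : (1 : F) - q ≠ 0 := by simpa using sub_ne_zero.2 (hq 1 one_pos).symm
  have hterm : ∀ k ∈ range N,
      (1 - q ^ (5 * (k + 1) + 2)) * bibasicWeight q (q ^ N) (k + 1) *
        (qp q q (3 * (k + 1)) / (qp q q (2 * (k + 1)) * qp (q ^ 3) (q ^ 2) (k + 1))) *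
          (qp (q ^ 2) (q ^ 4) (k + 1) * q ^ (k + 1) / qp q q (k + 1)) =
      ∑ i ∈ range N, (1 - q) * ((-1) ^ i * q ^ (6 * i ^ 2) * (1 - q ^ (8 * i + 2)) *
        qp (q ^ 2) (q ^ 4) i / qp (q ^ 4) (q ^ 4) i) * bibasicTerm q (q ^ N) i (k + 1) := by
    intro k hk
    have hk := Finset.mem_range.1 hk
    have h3 : (1 : F) - q ^ (3 * (k + 1)) ≠ 0 := sub_ne_zero.2 (hq _ (by omega)).symm
    have hs := sum_wpTerm hq0 hq (L := N) (k := k + 1) (by omega) (by omega)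
    have hl : ∑ i ∈ range N, (1 - q) * ((-1) ^ i * q ^ (6 * i ^ 2) * (1 - q ^ (8 * i + 2)) *
        qp (q ^ 2) (q ^ 4) i / qp (q ^ 4) (q ^ 4) i) * bibasicTerm q (q ^ N) i (k + 1) =
        (1 - q) * bibasicWeight q (q ^ N) (k + 1) * (1 - q ^ (5 * (k + 1) + 2)) *
          (1 - q ^ (3 * (k + 1))) * q ^ (k + 1) * ∑ i ∈ range N, wpTerm q (k + 1) i := by
      rw [Finset.mul_sum]
      refine Finset.sum_congr rfl fun i _ => ?_
      rw [wpTerm, bibasicTerm]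
      ring
    rw [hl, hs]
    field_simp
  rw [Finset.sum_range_succ', Finset.sum_congr rfl hterm, Finset.sum_comm]
  simp_rw [← Finset.mul_sum, sum_bibasicTerm hq0 hq hN]
  rw [Finset.sum_eq_single 0 (by intro i _ hi; simp [hi])
    (by intro h; exact absurd (Finset.mem_range.2 (by omega)) h)]
  simp [qp_zero, bibasicWeight]
  field_simp
  ring

end BibasicSums

section Specialization

variable {K : Type*} [Field K]

lemma qp_pow_ne_zero {ζ : K} {n a t k : ℕ} (hζ : IsPrimitiveRoot ζ n)
    (h : ∀ j < k, ¬n ∣ a + t * j) : qp (ζ ^ a) (ζ ^ t) k ≠ 0 :=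
  qp_ne_zero fun j hj => by
    rw [← pow_mul, ← pow_add, Ne, hζ.pow_eq_one_iff_dvd]
    exact h j hj

variable [Algebra ℚ K]

/-- The rational function `r` is regular at `ζ`, with value `v`. -/
def HasValueAt (ζ : K) (r : RatFunc ℚ) (v : K) : Prop :=
  ∃ p d : ℚ[X], aeval ζ d ≠ 0 ∧
    r = algebraMap ℚ[X] (RatFunc ℚ) p / algebraMap ℚ[X] (RatFunc ℚ) d ∧ v = aeval ζ p / aeval ζ d

namespace HasValueAt

variable {ζ : K} {r s : RatFunc ℚ} {v w : K}

lemma algebraMap_ne_zero {d : ℚ[X]} (hd : aeval ζ d ≠ 0) :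
    algebraMap ℚ[X] (RatFunc ℚ) d ≠ 0 :=
  RatFunc.algebraMap_ne_zero fun h => hd (by simp [h])

lemma of_polynomial (p : ℚ[X]) :
    HasValueAt ζ (algebraMap ℚ[X] (RatFunc ℚ) p) (aeval ζ p) :=
  ⟨p, 1, by simp, by simp, by simp⟩

lemma one : HasValueAt ζ 1 1 := by simpa using of_polynomial (ζ := ζ) 1

lemma X_pow (m : ℕ) : HasValueAt ζ (RatFunc.X ^ m) (ζ ^ m) := by
  simpa using of_polynomial (ζ := ζ) (X ^ m)

lemma sub (hr : HasValueAt ζ r v) (hs : HasValueAt ζ s w) : HasValueAt ζ (r - s) (v - w) := by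
  obtain ⟨p, d, hd, rfl, rfl⟩ := hr
  obtain ⟨p', d', hd', rfl, rfl⟩ := hs
  refine ⟨p * d' - d * p', d * d', by simp [hd, hd'], ?_, ?_⟩
  · rw [div_sub_div _ _ (algebraMap_ne_zero hd) (algebraMap_ne_zero hd')]
    simp
  · rw [div_sub_div _ _ hd hd']
    simp

lemma add (hr : HasValueAt ζ r v) (hs : HasValueAt ζ s w) : HasValueAt ζ (r + s) (v + w) := by
  obtain ⟨p, d, hd, rfl, rfl⟩ := hr
  obtain ⟨p', d', hd', rfl, rfl⟩ := hs
  refine ⟨p * d' + d * p', d * d', by simp [hd, hd'], ?_, ?_⟩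
  · rw [div_add_div _ _ (algebraMap_ne_zero hd) (algebraMap_ne_zero hd')]
    simp
  · rw [div_add_div _ _ hd hd']
    simp

lemma mul (hr : HasValueAt ζ r v) (hs : HasValueAt ζ s w) : HasValueAt ζ (r * s) (v * w) := by
  obtain ⟨p, d, hd, rfl, rfl⟩ := hr
  obtain ⟨p', d', hd', rfl, rfl⟩ := hs
  refine ⟨p * p', d * d', by simp [hd, hd'], ?_, ?_⟩ <;> simp [div_mul_div_comm]

lemma inv (hr : HasValueAt ζ r v) (hv : v ≠ 0) : HasValueAt ζ r⁻¹ v⁻¹ := by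
  obtain ⟨p, d, hd, rfl, rfl⟩ := hr
  exact ⟨d, p, fun h => hv (by simp [h]), by simp, by simp⟩

lemma div (hr : HasValueAt ζ r v) (hs : HasValueAt ζ s w) (hw : w ≠ 0) :
    HasValueAt ζ (r / s) (v / w) := by
  simpa only [div_eq_mul_inv] using hr.mul (hs.inv hw)

lemma sum {ι : Type*} {t : Finset ι} {f : ι → RatFunc ℚ} {g : ι → K}
    (h : ∀ i ∈ t, HasValueAt ζ (f i) (g i)) : HasValueAt ζ (∑ i ∈ t, f i) (∑ i ∈ t, g i) := by
  classical
  induction t using Finset.induction_on with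
  | empty => simpa using of_polynomial (ζ := ζ) 0
  | insert a t ha ih =>
    rw [Finset.sum_insert ha, Finset.sum_insert ha]
    exact (h a (by simp)).add (ih fun i hi => h i (by simp [hi]))

lemma prod {ι : Type*} {t : Finset ι} {f : ι → RatFunc ℚ} {g : ι → K}
    (h : ∀ i ∈ t, HasValueAt ζ (f i) (g i)) : HasValueAt ζ (∏ i ∈ t, f i) (∏ i ∈ t, g i) := by
  classical
  induction t using Finset.induction_on with
  | empty => simpa using one
  | insert a t ha ih =>
    rw [Finset.prod_insert ha, Finset.prod_insert ha]
    exact (h a (by simp)).mul (ih fun i hi => h i (by simp [hi]))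

lemma qint (m : ℕ) : HasValueAt ζ (qint m) (∑ i ∈ range m, ζ ^ i) :=
  sum fun i _ => X_pow i

lemma qp (a t k : ℕ) :
    HasValueAt ζ (qp (RatFunc.X ^ a) (RatFunc.X ^ t) k) (qp (ζ ^ a) (ζ ^ t) k) := by
  refine prod fun j _ => one.sub ?_
  simpa only [← pow_mul, ← pow_add] using X_pow (ζ := ζ) (a + t * j)

lemma minpoly_dvd_num (h : HasValueAt ζ r 0) (hζ : IsIntegral ℚ ζ) : minpoly ℚ ζ ∣ r.num := by
  obtain ⟨p, d, hd, hr, h0⟩ := h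
  have hp : aeval ζ p = 0 := by
    rcases div_eq_zero_iff.1 h0.symm with h | h
    exacts [h, absurd h hd]
  have hden := RatFunc.algebraMap_ne_zero (RatFunc.denom_ne_zero r)
  have hmul : r.num * d = p * r.denom := by
    apply RatFunc.algebraMap_injective ℚ
    rw [map_mul, map_mul, ← div_eq_div_iff hden (algebraMap_ne_zero hd), RatFunc.num_div_denom, hr]
  have hdvd : minpoly ℚ ζ ∣ r.num * d := hmul ▸ (minpoly.dvd ℚ ζ hp).mul_right _
  exact ((minpoly.prime hζ).dvd_or_dvd hdvd).resolve_right fun h =>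
    hd ((minpoly.dvd_iff).1 h)

end HasValueAt

lemma RatFunc.X_pow_ne_one {m : ℕ} (hm : 0 < m) : (RatFunc.X : RatFunc ℚ) ^ m ≠ 1 := by
  intro h
  have h' : (Polynomial.X : ℚ[X]) ^ m = 1 := by
    apply RatFunc.algebraMap_injective ℚ
    simpa using h
  have := congrArg Polynomial.natDegree h'
  simp at this
  omega

lemma qint_mul (m : ℕ) : qint m * (1 - RatFunc.X) = 1 - RatFunc.X ^ m :=
  geom_sum_mul_neg _ _

/-- The factor `(q²;q²)_{3k} / ((q²;q²)_{2k} (q⁶;q⁴)_k)` is regular at a primitive `n`-th root of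
unity, also at `k = (n - 1) / 2`, where its denominator vanishes. -/
lemma exists_hasValueAt_qp_div {ζ : K} {N : ℕ} (hN : 0 < N)
    (hζ : IsPrimitiveRoot ζ (2 * N + 1)) {k : ℕ} (hk : k ≤ N) :
    ∃ v, HasValueAt ζ (qp (RatFunc.X ^ 2) (RatFunc.X ^ 2) (3 * k) /
      (qp (RatFunc.X ^ 2) (RatFunc.X ^ 2) (2 * k) * qp (RatFunc.X ^ 6) (RatFunc.X ^ 4) k)) v := by
  have hcop : Nat.Coprime (2 * N + 1) 2 := by simp
  have hdvd : ∀ m, 0 < m → m < 2 * N + 1 → ¬2 * N + 1 ∣ 2 * m := fun m h0 h1 h =>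
    absurd (Nat.le_of_dvd h0 (hcop.dvd_of_dvd_mul_left h)) (by omega)
  have hne : ∀ j ≤ N, ∀ l < N, qp (ζ ^ 2) (ζ ^ 2) (2 * j) * qp (ζ ^ 6) (ζ ^ 4) l ≠ 0 := by
    refine fun j hj l hl => mul_ne_zero (qp_pow_ne_zero hζ fun i hi => ?_)
      (qp_pow_ne_zero hζ fun i hi => ?_)
    · have := hdvd (i + 1) (by omega) (by omega)
      rwa [show 2 + 2 * i = 2 * (i + 1) by ring]
    · have := hdvd (2 * i + 3) (by omega) (by omega)
      rwa [show 6 + 4 * i = 2 * (2 * i + 3) by ring]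
  rcases hk.lt_or_eq with hlt | rfl
  · exact ⟨_, (HasValueAt.qp 2 2 (3 * k)).div ((HasValueAt.qp 2 2 (2 * k)).mul (.qp 6 4 k))
      (hne k hk k hlt)⟩
  · obtain ⟨m, rfl⟩ : ∃ m, k = m + 1 := ⟨k - 1, by omega⟩
    have hsplit : qp (RatFunc.X ^ 2 : RatFunc ℚ) (RatFunc.X ^ 2) (3 * (m + 1)) =
        qp (RatFunc.X ^ 2) (RatFunc.X ^ 2) (2 * (m + 1)) * (1 - RatFunc.X ^ (4 * m + 6)) *
          qp (RatFunc.X ^ (4 * m + 8)) (RatFunc.X ^ 2) m := by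
      rw [show 3 * (m + 1) = (2 * (m + 1) + 1) + m by ring, qp, Finset.prod_range_add, ← qp,
        qp_succ]
      congr 1
      · congr 2
        ring
      · exact Finset.prod_congr rfl fun j _ => by ring
    have hlast : qp (RatFunc.X ^ 6 : RatFunc ℚ) (RatFunc.X ^ 4) (m + 1) =
        qp (RatFunc.X ^ 6) (RatFunc.X ^ 4) m * (1 - RatFunc.X ^ (4 * m + 6)) := by
      rw [qp_succ]
      congr 2
      ring
    have h1 : (1 : RatFunc ℚ) - RatFunc.X ^ (4 * m + 6) ≠ 0 :=
      sub_ne_zero.2 (RatFunc.X_pow_ne_one (by omega)).symm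
    refine ⟨_, Eq.subst (motive := fun r => HasValueAt ζ r _) ?_
      (((HasValueAt.qp 2 2 (2 * (m + 1))).mul (.qp (4 * m + 8) 2 m)).div
        ((HasValueAt.qp 2 2 (2 * (m + 1))).mul (.qp 6 4 m)) (hne (m + 1) le_rfl m (by omega)))⟩
    rw [hsplit, hlast, ← mul_div_mul_right _ _ h1]
    congr 1 <;> ring

lemma hasValueAt_bibasicWeight {ζ : K} {N k : ℕ} (hζ : IsPrimitiveRoot ζ (2 * N + 1))
    (hd : qp (ζ ^ 11) (ζ ^ 8) k * qp (ζ ^ 9) (ζ ^ 8) k ≠ 0) :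
    HasValueAt ζ (bibasicWeight (RatFunc.X ^ 2) ((RatFunc.X ^ 2) ^ N) k)
      (qp (ζ ^ 1) (ζ ^ 2) k * qp (ζ ^ 3) (ζ ^ 2) k /
        (qp (ζ ^ 11) (ζ ^ 8) k * qp (ζ ^ 9) (ζ ^ 8) k)) := by
  have h0 : ζ ≠ 0 := hζ.ne_zero (by omega)
  have hinv : ζ ^ (2 * N) = ζ⁻¹ := by
    refine eq_inv_of_mul_eq_one_left ?_
    rw [← pow_succ, hζ.pow_eq_one]
  simp only [qp] at hd ⊢
  rw [← Finset.prod_mul_distrib, Finset.prod_ne_zero_iff] at hd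
  rw [← Finset.prod_mul_distrib, ← Finset.prod_mul_distrib, ← Finset.prod_div_distrib]
  refine HasValueAt.prod fun l hl => ?_
  have hdl := hd l hl
  obtain ⟨hd1, hd2⟩ := mul_ne_zero_iff.1 hdl
  simp only [← pow_mul, ← pow_add]
  have e2 : ζ ^ (2 * (l + 2) + 2 * N) = ζ ^ (3 + 2 * l) := by
    rw [pow_add, hinv, show 2 * (l + 2) = 3 + 2 * l + 1 by ring, pow_succ, mul_inv_cancel_right₀ h0]
  have e3 : ζ ^ (2 * (4 * l + 6) + 2 * N) = ζ ^ (11 + 8 * l) := by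
    rw [pow_add, hinv, show 2 * (4 * l + 6) = 11 + 8 * l + 1 by ring, pow_succ,
      mul_inv_cancel_right₀ h0]
  have e1 : ζ ^ (2 * N) - ζ ^ (2 * l) = ζ⁻¹ * (1 - ζ ^ (1 + 2 * l)) := by
    rw [hinv, mul_sub, mul_one, pow_add, pow_one, inv_mul_cancel_left₀ h0]
  have e4 : ζ ^ (2 * N) - ζ ^ (2 * (4 * l + 4)) = ζ⁻¹ * (1 - ζ ^ (9 + 8 * l)) := by
    rw [hinv, mul_sub, mul_one, show 9 + 8 * l = 1 + 2 * (4 * l + 4) by ring, pow_add ζ 1, pow_one,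
      inv_mul_cancel_left₀ h0]
  simp only [← pow_mul, ← pow_add] at hd1 hd2
  have hz := inv_ne_zero h0
  convert (((HasValueAt.X_pow (2 * N)).sub (.X_pow (2 * l))).mul
    (HasValueAt.one.sub (.X_pow (2 * (l + 2) + 2 * N)))).div
    ((HasValueAt.one.sub (.X_pow (2 * (4 * l + 6) + 2 * N))).mul
      ((HasValueAt.X_pow (2 * N)).sub (.X_pow (2 * (4 * l + 4))))) ?_ using 1
  · rw [e1, e2, e3, e4]
    field_simp
  · rw [e3, e4]
    exact mul_ne_zero hd1 (mul_ne_zero hz hd2)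

end Specialization

/-- for `n ≡ 5, 7 (mod 8)`, a truncated quartic sum is
congruent to 0 modulo `Φ_n(q)`. -/
theorem stmt17 (n : ℕ) (hn : 0 < n) (hmod : n % 8 = 5 ∨ n % 8 = 7) :
    letI q : RatFunc ℚ := RatFunc.X
    Polynomial.cyclotomic n ℚ ∣
      (∑ k ∈ Finset.range ((n - 1) / 2 + 1),
        qint (10 * k + 4) * qp q (q ^ 2) k * qp (q ^ 3) (q ^ 2) k *
            qp (q ^ 2) (q ^ 2) (3 * k) * qp (q ^ 4) (q ^ 8) k /
          (qp (q ^ 11) (q ^ 8) k * qp (q ^ 9) (q ^ 8) k * qp (q ^ 2) (q ^ 2) (2 * k) *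
            qp (q ^ 6) (q ^ 4) k * qp (q ^ 2) (q ^ 2) k) * q ^ (2 * k)).num := by
  obtain ⟨N, rfl⟩ : ∃ N, n = 2 * N + 1 := ⟨n / 2, by omega⟩
  rw [show (2 * N + 1 - 1) / 2 + 1 = N + 1 by omega]
  have hζ := Complex.isPrimitiveRoot_exp (2 * N + 1) hn.ne'
  generalize Complex.exp _ = ζ at hζ
  rw [cyclotomic_eq_minpoly_rat hζ hn]
  refine HasValueAt.minpoly_dvd_num ?_ (hζ.isIntegral hn).tower_top
  have hX : (1 : RatFunc ℚ) - RatFunc.X ≠ 0 := by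
    simpa using sub_ne_zero.2 (RatFunc.X_pow_ne_one one_pos).symm
  have hquartic := quartic_sum (q := (RatFunc.X : RatFunc ℚ) ^ 2) (pow_ne_zero 2 RatFunc.X_ne_zero)
    (fun m hm => by rw [← pow_mul]; exact RatFunc.X_pow_ne_one (by omega))
    (N := N) (by omega)
  simp only [← pow_mul] at hquartic
  rw [← sub_zero (∑ k ∈ range (N + 1), _), ← zero_div (1 - RatFunc.X), ← hquartic, Finset.sum_div,
    ← Finset.sum_sub_distrib, ← Finset.sum_const_zero (s := range (N + 1))]
  refine HasValueAt.sum fun k hk => ?_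
  have hk : k ≤ N := by
    have := Finset.mem_range.1 hk
    omega
  have hnd : ∀ a j : ℕ, (a = 11 ∨ a = 9) → j < k → ¬2 * N + 1 ∣ a + 8 * j := by
    rintro a j ha hj ⟨c, hc⟩
    have hc5 : c < 5 := by
      by_contra! h
      have := Nat.mul_le_mul_left (2 * N + 1) h
      omega
    interval_cases c <;> omega
  have hd11 : qp (ζ ^ 11) (ζ ^ 8) k ≠ 0 := qp_pow_ne_zero hζ fun j => hnd 11 j (.inl rfl)
  have hd9 : qp (ζ ^ 9) (ζ ^ 8) k ≠ 0 := qp_pow_ne_zero hζ fun j => hnd 9 j (.inr rfl)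
  have hd2 : qp (ζ ^ 2) (ζ ^ 2) k ≠ 0 := qp_pow_ne_zero hζ fun j hj ⟨c, hc⟩ => by
    have hc2 : c < 2 := by
      by_contra! h
      have := Nat.mul_le_mul_left (2 * N + 1) h
      omega
    interval_cases c <;> omega
  obtain ⟨v, hv⟩ := exists_hasValueAt_qp_div (by omega) hζ hk
  have hd := mul_ne_zero hd11 hd9
  have hcommon := ((HasValueAt.qint (ζ := ζ) (10 * k + 4)).mul hv).mul
    (((HasValueAt.qp 4 8 k).mul (.X_pow (2 * k))).div (.qp 2 2 k) hd2)
  have hdiff := ((((HasValueAt.qp (ζ := ζ) 1 2 k).mul (.qp 3 2 k)).div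
    ((HasValueAt.qp 11 8 k).mul (.qp 9 8 k)) hd).sub
    (hasValueAt_bibasicWeight hζ hd))
  rw [sub_self] at hdiff
  have hprod := hcommon.mul hdiff
  rw [mul_zero] at hprod
  convert hprod using 1
  rw [eq_comm, mul_sub]
  norm_num only [pow_one, ← pow_mul]
  congr 1
  · ring
  · rw [show 2 * (5 * k + 2) = 10 * k + 4 by ring, ← qint_mul]
    field_simp
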